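/- arXiv:0802.4333 — 8 statements merged into one kernel-verified Lean document; each statement's English description precedes it below -/
import Mathlib

section
/- Let w(t) = (1+t²) exp(|t| / log(e+|t|)) on ℝ. Then for every t ≠ 0 the Domar series diverges: Σ_{n=1}^∞ log⁺ w(nt)/n² = +∞. -/
open Filter in
/-- A series whose terms dominate the increments of a sequence tending to infinity diverges. -/
theorem not_summable_of_sub_le {f u : ℕ → ℝ} (h : ∀ n, u (n + 1) - u n ≤ f n)
    (hu : Tendsto u atTop atTop) : ¬ Summable f := by
  intro hs
  refine not_tendsto_atTop_of_tendsto_nhds hs.hasSum.tendsto_sum_nat ?_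
  refine tendsto_atTop_mono (fun n => ?_) (tendsto_atTop_add_const_right atTop (-u 0) hu)
  rw [← sub_eq_add_neg, ← Finset.sum_range_sub u n]
  exact Finset.sum_le_sum fun i _ => h i

/-- Increments of `log ∘ log` are controlled by `h / (x * log x)`. -/
theorem log_log_add_sub_le {x h : ℝ} (hx : 1 < x) (hh : 0 ≤ h) :
    Real.log (Real.log (x + h)) - Real.log (Real.log x) ≤ h / (x * Real.log x) := by
  have hx0 : 0 < x := by linarith
  have hL : 0 < Real.log x := Real.log_pos hx
  have hL' : 0 < Real.log (x + h) := Real.log_pos (by linarith)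
  have h1 : Real.log (x + h) - Real.log x ≤ h / x := by
    rw [← Real.log_div (by linarith) hx0.ne']
    refine (Real.log_le_sub_one_of_pos (by positivity)).trans_eq ?_
    field_simp
    ring
  rw [← Real.log_div hL'.ne' hL.ne']
  calc Real.log (Real.log (x + h) / Real.log x)
      ≤ Real.log (x + h) / Real.log x - 1 := Real.log_le_sub_one_of_pos (by positivity)
    _ = (Real.log (x + h) - Real.log x) / Real.log x := by field_simp
    _ ≤ h / x / Real.log x := by gcongr
    _ = h / (x * Real.log x) := by rw [div_div]

/-- For the weight `w(t) = (1+t²) exp(|t|/log(e+|t|))` on `ℝ`, the Domar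
series `Σ_{n≥1} log⁺ w(nt)/n²` diverges for every `t ≠ 0`. (The index `n ≥ 1` is
written as `n + 1` with `n : ℕ`.) -/
theorem domar_series_diverges_quasianalytic_weight
    (w : ℝ → ℝ)
    (hw : ∀ t : ℝ, w t = (1 + t ^ 2) * Real.exp (|t| / Real.log (Real.exp 1 + |t|))) :
    ∀ t : ℝ, t ≠ 0 →
      ¬ Summable (fun n : ℕ =>
        max 0 (Real.log (w (((n : ℝ) + 1) * t))) / ((n : ℝ) + 1) ^ 2) := by
  intro t ht
  have ha : 0 < |t| := abs_pos.mpr ht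
  have he : 1 < Real.exp 1 := Real.one_lt_exp_iff.mpr one_pos
  refine not_summable_of_sub_le
    (u := fun n => |t| * Real.log (Real.log (Real.exp 1 + ((n : ℝ) + 1) * |t|))) (fun n => ?_) ?_
  · have hn : (0 : ℝ) < (n : ℝ) + 1 := by positivity
    have hna : 0 < ((n : ℝ) + 1) * |t| := by positivity
    have hx : 1 < Real.exp 1 + ((n : ℝ) + 1) * |t| := by linarith
    have hL : 0 < Real.log (Real.exp 1 + ((n : ℝ) + 1) * |t|) := Real.log_pos hx
    have hlog : ((n : ℝ) + 1) * |t| / Real.log (Real.exp 1 + ((n : ℝ) + 1) * |t|) ≤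
        Real.log (w (((n : ℝ) + 1) * t)) := by
      rw [hw, Real.log_mul (by positivity) (Real.exp_ne_zero _), Real.log_exp, abs_mul,
        abs_of_pos hn]
      linarith [Real.log_nonneg (le_add_of_nonneg_right (sq_nonneg (((n : ℝ) + 1) * t)) :
        (1 : ℝ) ≤ 1 + (((n : ℝ) + 1) * t) ^ 2)]
    have hstep := log_log_add_sub_le hx ha.le
    rw [show Real.exp 1 + ((n : ℝ) + 1) * |t| + |t| =
      Real.exp 1 + (((n + 1 : ℕ) : ℝ) + 1) * |t| by push_cast; ring] at hstep
    calc |t| * Real.log (Real.log (Real.exp 1 + (((n + 1 : ℕ) : ℝ) + 1) * |t|)) -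
          |t| * Real.log (Real.log (Real.exp 1 + ((n : ℝ) + 1) * |t|))
        ≤ |t| * (|t| / ((Real.exp 1 + ((n : ℝ) + 1) * |t|) *
            Real.log (Real.exp 1 + ((n : ℝ) + 1) * |t|))) := by
          rw [← mul_sub]
          gcongr
      _ ≤ |t| * (|t| / ((((n : ℝ) + 1) * |t|) *
            Real.log (Real.exp 1 + ((n : ℝ) + 1) * |t|))) := by
          gcongr
          linarith
      _ = ((n : ℝ) + 1) * |t| / Real.log (Real.exp 1 + ((n : ℝ) + 1) * |t|) /
            ((n : ℝ) + 1) ^ 2 := by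
          field_simp
      _ ≤ max 0 (Real.log (w (((n : ℝ) + 1) * t))) / ((n : ℝ) + 1) ^ 2 := by
          gcongr
          exact hlog.trans (le_max_right _ _)
  · refine Filter.Tendsto.const_mul_atTop ha
      (Real.tendsto_log_atTop.comp (Real.tendsto_log_atTop.comp ?_))
    exact Filter.tendsto_atTop_add_const_left _ _ (Filter.Tendsto.atTop_mul_const ha
      (Filter.tendsto_atTop_add_const_right _ _ tendsto_natCast_atTop_atTop))
end

section
/- Let G be an abelian group equal to the union of an increasing sequence of finite subgroups G_n (G = ∪_n G_n, G_n ⊆ G_{n+1} for all n ∈ ℕ). Then there exists a function u : G → ℝ such that: (a) u(x) > 0 for all x; (b) Σ_{y ∈ G} u(y) u(x−y) ≤ u(x) for all x ∈ G (in particular the sum converges); (c) u(−x) = u(x) for all x; (d) for every x ∈ G there exist C > 0 and d ∈ ℕ with 1/u(nx) ≤ C n^d for all n ≥ 1. -/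
/-- A summable positive function with sum at most `1 / 2` satisfying the ultrametric inequality
`min (u y) (u (x - y)) ≤ u x` dominates its own convolution square. -/
lemma convolution_self_le_of_min_le {G : Type*} [AddCommGroup G] {u : G → ℝ}
    (hpos : ∀ x, 0 < u x) (hmin : ∀ x y, min (u y) (u (x - y)) ≤ u x)
    (hsum : Summable u) (hle : ∑' x, u x ≤ 1 / 2) (x : G) :
    Summable (fun y => u y * u (x - y)) ∧ ∑' y, u y * u (x - y) ≤ u x := by
  have hsub : Summable fun y => u (x - y) := (Equiv.subLeft x).summable_iff.2 hsum
  have htsub : ∑' y, u (x - y) = ∑' y, u y := (Equiv.subLeft x).tsum_eq u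
  have hbound : ∀ y, u y * u (x - y) ≤ u x * (u y + u (x - y)) := fun y => by
    have h1 := hpos y
    have h2 := hpos (x - y)
    have h3 := hpos x
    rcases min_le_iff.1 (hmin x y) with h | h <;> nlinarith
  have hdom : Summable fun y => u x * (u y + u (x - y)) := (hsum.add hsub).mul_left _
  have hconv : Summable fun y => u y * u (x - y) :=
    hdom.of_nonneg_of_le (fun y => (mul_pos (hpos y) (hpos _)).le) hbound
  refine ⟨hconv, (hconv.tsum_le_tsum hbound hdom).trans ?_⟩
  rw [tsum_mul_left, hsum.tsum_add hsub, htsub]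
  nlinarith [hpos x]

/-- If the sublevel sets of `l : α → ℕ` are finite, then assigning to each `x` the weight
`2⁻¹ ^ (l x + 2)` divided by the size of its sublevel set gives finite sums at most `1 / 2`. -/
lemma sum_two_inv_pow_div_ncard_le {α : Type*} (l : α → ℕ) (hl : ∀ n, {x | l x ≤ n}.Finite)
    (s : Finset α) :
    ∑ x ∈ s, (2⁻¹ : ℝ) ^ (l x + 2) / ({y | l y ≤ l x}.ncard : ℝ) ≤ 1 / 2 := by
  classical
  rw [← Finset.sum_fiberwise_of_maps_to (t := s.image l)
    (fun x hx => Finset.mem_image_of_mem l hx)]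
  have hgeom : HasSum (fun n : ℕ => (2⁻¹ : ℝ) ^ (n + 2)) (1 / 2) := by
    have h := (hasSum_geometric_of_lt_one (r := (2⁻¹ : ℝ)) (by norm_num) (by norm_num)).mul_right
      ((2⁻¹ : ℝ) ^ 2)
    simp only [← pow_add] at h
    rwa [show (1 - (2⁻¹ : ℝ))⁻¹ * 2⁻¹ ^ 2 = 1 / 2 by norm_num] at h
  refine (Finset.sum_le_sum fun n _ => ?_).trans
    (sum_le_hasSum (s.image l) (fun n _ => by positivity) hgeom)
  have hcard : (s.filter fun x => l x = n).card ≤ {y | l y ≤ n}.ncard := by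
    rw [← Set.ncard_coe_finset]
    exact Set.ncard_le_ncard (fun x hx => (Finset.mem_filter.1 hx).2.le) (hl n)
  calc ∑ x ∈ s with l x = n, (2⁻¹ : ℝ) ^ (l x + 2) / ({y | l y ≤ l x}.ncard : ℝ)
      = ∑ x ∈ s with l x = n, (2⁻¹ : ℝ) ^ (n + 2) / ({y | l y ≤ n}.ncard : ℝ) :=
        Finset.sum_congr rfl fun x hx => by rw [(Finset.mem_filter.1 hx).2]
    _ = (2⁻¹ : ℝ) ^ (n + 2) *
          (((s.filter fun x => l x = n).card : ℝ) / ({y | l y ≤ n}.ncard : ℝ)) := by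
        rw [Finset.sum_const, nsmul_eq_mul]
        ring
    _ ≤ (2⁻¹ : ℝ) ^ (n + 2) :=
        mul_le_of_le_one_right (by positivity)
          (div_le_one_of_le₀ (by exact_mod_cast hcard) (by positivity))


/-- On an abelian group which is the union of an increasing sequence of
finite subgroups, there is a function `u` which is positive (a), satisfies `u*u ≤ u`
pointwise with the convolution sum converging (b), is even (c), and `1/u(nx)` grows at
most polynomially in `n` for every `x` (d). -/
theorem exists_weight_union_finite_subgroups
    {G : Type*} [AddCommGroup G]
    (Gn : ℕ → AddSubgroup G)
    (h_fin : ∀ n, (Gn n : Set G).Finite)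
    (h_mono : ∀ n, Gn n ≤ Gn (n + 1))
    (h_union : ∀ x : G, ∃ n, x ∈ Gn n) :
    ∃ u : G → ℝ,
      (∀ x, 0 < u x) ∧
      (∀ x : G, Summable (fun y : G => u y * u (x - y)) ∧
        ∑' y : G, u y * u (x - y) ≤ u x) ∧
      (∀ x, u (-x) = u x) ∧
      (∀ x : G, ∃ C > (0 : ℝ), ∃ d : ℕ, ∀ n : ℕ, 1 ≤ n →
        1 / u (n • x) ≤ C * (n : ℝ) ^ d) := by
  classical
  let l : G → ℕ := fun x => Nat.find (h_union x)
  have hl : ∀ x n, l x ≤ n ↔ x ∈ Gn n := fun x n =>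
    ⟨fun h => monotone_nat_of_le_succ h_mono h (Nat.find_spec (h_union x)),
      fun h => Nat.find_min' (h_union x) h⟩
  have hfin : ∀ n, {x | l x ≤ n}.Finite := fun n =>
    (h_fin n).subset fun x hx => (hl x n).1 hx
  let u : G → ℝ := fun x => (2⁻¹ : ℝ) ^ (l x + 2) / ({y | l y ≤ l x}.ncard : ℝ)
  have hcard : ∀ x, 0 < ({y | l y ≤ l x}.ncard : ℝ) := fun x => by
    exact_mod_cast (Set.ncard_pos (hfin _)).2 ⟨x, le_refl (l x)⟩
  have hpos : ∀ x, 0 < u x := fun x => div_pos (by positivity) (hcard x)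
  have hanti : ∀ {x y}, l x ≤ l y → u y ≤ u x := fun {x y} h =>
    div_le_div₀ (by positivity)
      (pow_le_pow_of_le_one (by norm_num) (by norm_num) (by omega)) (hcard x)
      (by exact_mod_cast Set.ncard_le_ncard (fun z hz => le_trans hz h) (hfin _))
  have hsum := sum_two_inv_pow_div_ncard_le l hfin
  have hmin : ∀ x y, min (u y) (u (x - y)) ≤ u x := fun x y => by
    rcases le_total (l y) (l (x - y)) with h | h
    · refine min_le_of_right_le (hanti ((hl _ _).2 ?_))
      simpa using add_mem ((hl _ _).1 h) ((hl _ _).1 le_rfl)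
    · refine min_le_of_left_le (hanti ((hl _ _).2 ?_))
      simpa using add_mem ((hl _ _).1 le_rfl) ((hl _ _).1 h)
  refine ⟨u, hpos,
    convolution_self_le_of_min_le hpos hmin
      (summable_of_sum_le (fun x => (hpos x).le) hsum)
      ((summable_of_sum_le (fun x => (hpos x).le) hsum).tsum_le_of_sum_le hsum),
    fun x => ?_, fun x => ⟨1 / u x, one_div_pos.2 (hpos x), 0, fun n _ => ?_⟩⟩
  · exact le_antisymm (hanti ((hl _ _).2 (by simpa using neg_mem ((hl (-x) _).1 le_rfl))))
      (hanti ((hl _ _).2 (neg_mem ((hl x _).1 le_rfl))))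
  · rw [pow_zero, mul_one]
    exact one_div_le_one_div_of_le (hpos x)
      (hanti ((hl _ _).2 (nsmul_mem ((hl x _).1 le_rfl) n)))
end

section
/- Let p be a prime and let Z(p^∞) be the Prüfer p-group, i.e. the subgroup {k/p^n mod 1 : k ∈ ℤ, n ∈ ℕ} of ℚ/ℤ with addition modulo 1. Then there exists a function u : Z(p^∞) → ℝ such that: (a) u(x) > 0 for all x; (b) Σ_{y} u(y) u(x−y) ≤ u(x) for all x; (c) u(−x) = u(x) for all x; (d) for every x there exist C > 0 and d ∈ ℕ with 1/u(nx) ≤ C n^d for all n ≥ 1. -/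
/-- Every element of `ℚ/ℤ` has finite order. -/
theorem isOfFinAddOrder_rat_quotient (x : ℚ ⧸ AddSubgroup.zmultiples (1 : ℚ)) :
    IsOfFinAddOrder x := by
  obtain ⟨q, rfl⟩ := QuotientAddGroup.mk_surjective x
  refine isOfFinAddOrder_iff_nsmul_eq_zero.mpr ⟨q.den, q.den_pos, ?_⟩
  rw [← QuotientAddGroup.mk_nsmul, QuotientAddGroup.eq_zero_iff]
  exact ⟨q.num, by simp [mul_comm, Rat.mul_den_eq_num]⟩

/-- The inverse fourth power of the order is summable over `ℚ/ℤ`. -/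
theorem summable_inv_addOrderOf_pow_four :
    Summable fun x : ℚ ⧸ AddSubgroup.zmultiples (1 : ℚ) => 1 / (addOrderOf x : ℝ) ^ 4 := by
  have hrep : ∀ x : ℚ ⧸ AddSubgroup.zmultiples (1 : ℚ), ∃ m : ℕ,
      m < addOrderOf x ∧ (((m : ℚ) / addOrderOf x : ℚ) : ℚ ⧸ AddSubgroup.zmultiples (1 : ℚ)) = x := by
    intro x
    obtain ⟨m, -, hm, h⟩ := AddCircle.exists_gcd_eq_one_of_isOfFinAddOrder (p := (1 : ℚ))
      (isOfFinAddOrder_rat_quotient x)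
    exact ⟨m, hm, by simpa only [mul_one] using h⟩
  choose m hlt hm using hrep
  have hinj : Function.Injective fun x => (m x, addOrderOf x) := by
    intro x y hxy
    obtain ⟨h₁, h₂⟩ := Prod.mk.inj hxy
    rw [← hm x, ← hm y, h₁, h₂]
  have hs : Summable fun n : ℕ => 1 / (n : ℝ) ^ 2 :=
    Real.summable_one_div_nat_pow.mpr one_lt_two
  have hs' : Summable fun n : ℕ => 1 / ((n + 1 : ℕ) : ℝ) ^ 2 :=
    (summable_nat_add_iff 1).mpr hs
  refine ((hs'.mul_of_nonneg hs (fun _ => by positivity)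
    (fun _ => by positivity)).comp_injective hinj).of_nonneg_of_le
    (fun _ => by positivity) fun x => ?_
  have hle : ((m x + 1 : ℕ) : ℝ) ≤ addOrderOf x := Nat.cast_le.mpr (hlt x)
  have hpos : (0 : ℝ) < ((m x + 1 : ℕ) : ℝ) := by positivity
  have hpos' : (0 : ℝ) < addOrderOf x := hpos.trans_le hle
  simp only [Function.comp_apply]
  rw [one_div_mul_one_div]
  refine one_div_le_one_div_of_le (by positivity) ?_
  calc ((m x + 1 : ℕ) : ℝ) ^ 2 * (addOrderOf x : ℝ) ^ 2
      ≤ (addOrderOf x : ℝ) ^ 2 * (addOrderOf x : ℝ) ^ 2 := by gcongr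
    _ = (addOrderOf x : ℝ) ^ 4 := by ring

/-- The order satisfies the ultrametric inequality on `p`-primary elements. -/
theorem addOrderOf_add_le_max_of_prime_pow {G : Type*} [AddCommGroup G] {p : ℕ} (hp : p.Prime)
    {x y : G} {a b : ℕ} (hx : p ^ a • x = 0) (hy : p ^ b • y = 0) :
    addOrderOf (x + y) ≤ max (addOrderOf x) (addOrderOf y) := by
  obtain ⟨i, -, hi⟩ := (Nat.dvd_prime_pow hp).mp (addOrderOf_dvd_of_nsmul_eq_zero hx)
  obtain ⟨j, -, hj⟩ := (Nat.dvd_prime_pow hp).mp (addOrderOf_dvd_of_nsmul_eq_zero hy)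
  have h := (AddCommute.all x y).addOrderOf_add_dvd_lcm
  rw [hi, hj] at h ⊢
  rcases le_total i j with hij | hij
  · rw [Nat.lcm_eq_right (pow_dvd_pow p hij)] at h
    exact (Nat.le_of_dvd (pow_pos hp.pos j) h).trans (le_max_right _ _)
  · rw [Nat.lcm_eq_left (pow_dvd_pow p hij)] at h
    exact (Nat.le_of_dvd (pow_pos hp.pos i) h).trans (le_max_left _ _)


/-- On the Prüfer `p`-group `Z(p^∞) = {k/pⁿ mod 1} ⊆ ℚ/ℤ` there is a
function `u` which is positive (a), satisfies `u*u ≤ u` with the convolution sum over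
the subgroup converging (b), is even (c), and `1/u(nx)` grows at most polynomially (d).
Here `ℚ/ℤ` is realized as the quotient `ℚ ⧸ ℤ·1` and `Z(p^∞)` as the subset `S`. -/
theorem exists_weight_prufer_group
    (p : ℕ) (hp : p.Prime)
    (S : Set (ℚ ⧸ AddSubgroup.zmultiples (1 : ℚ)))
    (hS : S = {x : ℚ ⧸ AddSubgroup.zmultiples (1 : ℚ) |
      ∃ (k : ℤ) (n : ℕ), x = ((k : ℚ) / (p : ℚ) ^ n : ℚ)}) :
    ∃ u : (ℚ ⧸ AddSubgroup.zmultiples (1 : ℚ)) → ℝ,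
      (∀ x ∈ S, 0 < u x) ∧
      (∀ x ∈ S, Summable (fun y : S => u y * u (x - y)) ∧
        ∑' y : S, u y * u (x - y) ≤ u x) ∧
      (∀ x ∈ S, u (-x) = u x) ∧
      (∀ x ∈ S, ∃ C > (0 : ℝ), ∃ d : ℕ, ∀ n : ℕ, 1 ≤ n →
        1 / u (n • x) ≤ C * (n : ℝ) ^ d) := by
  have htors : ∀ x ∈ S, ∃ n : ℕ, p ^ n • x = 0 := by
    rw [hS]
    rintro _ ⟨k, n, rfl⟩
    refine ⟨n, ?_⟩
    rw [← QuotientAddGroup.mk_nsmul, QuotientAddGroup.eq_zero_iff]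
    have hp0 : (p : ℚ) ≠ 0 := Nat.cast_ne_zero.mpr hp.ne_zero
    exact ⟨k, by simp; field_simp⟩
  let v : (ℚ ⧸ AddSubgroup.zmultiples (1 : ℚ)) → ℝ := fun x => 1 / (addOrderOf x : ℝ) ^ 4
  have hord : ∀ x : ℚ ⧸ AddSubgroup.zmultiples (1 : ℚ), (0 : ℝ) < addOrderOf x := fun x =>
    Nat.cast_pos.mpr (isOfFinAddOrder_rat_quotient x).addOrderOf_pos
  have hvpos : ∀ x, 0 < v x := fun x => by have := hord x; positivity
  have hv : Summable v := summable_inv_addOrderOf_pow_four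
  let T : ℝ := ∑' x, v x
  have hT : 0 < T := hv.tsum_pos (fun x => (hvpos x).le) 0 (hvpos 0)
  have hanti : ∀ x y, addOrderOf x ≤ addOrderOf y → v y ≤ v x := fun x y h => by
    have := hord x
    refine one_div_le_one_div_of_le (by positivity) ?_
    gcongr
  have hmul : ∀ x ∈ S, ∀ y ∈ S, v y * v (x - y) ≤ v x * (v y + v (x - y)) := by
    intro x hx y hy
    obtain ⟨a, ha⟩ := htors x hx
    obtain ⟨b, hb⟩ := htors y hy
    have hxy : p ^ (a + b) • (x - y) = 0 := by
      rw [nsmul_sub, pow_add, mul_nsmul, ha, mul_comm, mul_nsmul, hb]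
      simp
    have hle := addOrderOf_add_le_max_of_prime_pow hp hb hxy
    rw [add_sub_cancel] at hle
    have h₁ := hvpos y
    have h₂ := hvpos (x - y)
    have h₃ := hvpos x
    rcases le_max_iff.mp hle with h | h
    · nlinarith [hanti _ _ h]
    · nlinarith [hanti _ _ h]
  have hsub : ∀ x, Function.Injective fun y : S => x - (y : ℚ ⧸ AddSubgroup.zmultiples (1 : ℚ)) :=
    fun x => sub_right_injective.comp Subtype.val_injective
  have hs₁ : Summable fun y : S => v y := hv.comp_injective Subtype.val_injective
  have hs₂ : ∀ x, Summable fun y : S => v (x - y) := fun x => hv.comp_injective (hsub x)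
  have ht₁ : ∑' y : S, v y ≤ T :=
    tsum_comp_le_tsum_of_inj hv (fun x => (hvpos x).le) Subtype.val_injective
  have ht₂ : ∀ x, ∑' y : S, v (x - y) ≤ T := fun x =>
    tsum_comp_le_tsum_of_inj hv (fun x => (hvpos x).le) (hsub x)
  have hconv : ∀ x ∈ S, Summable (fun y : S => v y * v (x - y)) ∧
      ∑' y : S, v y * v (x - y) ≤ v x * (2 * T) := by
    intro x hx
    have hdom : Summable fun y : S => v x * (v y + v (x - y)) :=
      (hs₁.add (hs₂ x)).mul_left (v x)
    have hs : Summable fun y : S => v y * v (x - y) :=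
      hdom.of_nonneg_of_le (fun y => (mul_pos (hvpos _) (hvpos _)).le)
        fun y : S => hmul x hx y y.2
    refine ⟨hs, (hs.tsum_le_tsum (fun y : S => hmul x hx y y.2) hdom).trans ?_⟩
    rw [tsum_mul_left, hs₁.tsum_add (hs₂ x)]
    exact mul_le_mul_of_nonneg_left (by linarith [ht₂ x]) (hvpos x).le
  refine ⟨fun x => v x / (2 * T), fun x _ => div_pos (hvpos x) (by positivity),
    fun x hx => ?_, fun x _ => by simp only [v, addOrderOf_neg], fun x _ => ?_⟩
  · obtain ⟨hs, hle⟩ := hconv x hx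
    have heq : (fun y : S => v y / (2 * T) * (v (x - y) / (2 * T))) =
        fun y : S => v y * v (x - y) / (2 * T) ^ 2 := by
      funext y
      ring
    rw [heq, tsum_div_const]
    refine ⟨hs.div_const _, ?_⟩
    rw [div_le_div_iff₀ (by positivity) (by positivity)]
    calc (∑' y : S, v y * v (x - y)) * (2 * T) ≤ v x * (2 * T) * (2 * T) := by gcongr
      _ = v x * (2 * T) ^ 2 := by ring
  · refine ⟨1 / (v x / (2 * T)), one_div_pos.mpr (div_pos (hvpos x) (by positivity)), 0,
      fun n _ => ?_⟩
    rw [pow_zero, mul_one]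
    refine one_div_le_one_div_of_le (div_pos (hvpos x) (by positivity)) ?_
    have hn : addOrderOf (n • x) ≤ addOrderOf x :=
      Nat.le_of_dvd (isOfFinAddOrder_rat_quotient x).addOrderOf_pos
        (addOrderOf_dvd_of_nsmul_eq_zero (by
          rw [nsmul_left_comm, addOrderOf_nsmul_eq_zero, nsmul_zero]))
    have := hanti _ _ hn
    exact div_le_div_of_nonneg_right this (by positivity)
end

section
/- On the discrete additive group ℚ of rational numbers there exists a function u : ℚ → ℝ such that: (a) u(x) > 0 for all x; (b) Σ_{y ∈ ℚ} u(y) u(x−y) ≤ u(x) for all x ∈ ℚ; (c) u(−x) = u(x) for all x; (d) for every q ∈ ℚ there exists C > 0 with 1/u(nq) ≤ C n² for all n ≥ 1. -/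
/-- A rational multiplied by a large enough factorial is an integer. -/
theorem Rat.exists_mul_factorial_eq_int (x : ℚ) :
    ∃ k : ℕ, ∃ m : ℤ, x * (k.factorial : ℚ) = m := by
  obtain ⟨c, hc⟩ := Nat.dvd_factorial x.den_pos le_rfl
  refine ⟨x.den, x.num * c, ?_⟩
  rw [hc]
  push_cast
  rw [← mul_assoc, Rat.mul_den_eq_num]

open Classical in
/-- The least `k` such that `k ! * x` is an integer. -/
noncomputable def Rat.factorialLevel (x : ℚ) : ℕ :=
  Nat.find x.exists_mul_factorial_eq_int

theorem Rat.factorialLevel_spec (x : ℚ) :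
    ∃ m : ℤ, x * (x.factorialLevel.factorial : ℚ) = m := by
  classical exact Nat.find_spec x.exists_mul_factorial_eq_int

theorem Rat.factorialLevel_le_iff {x : ℚ} {k : ℕ} :
    x.factorialLevel ≤ k ↔ ∃ m : ℤ, x * (k.factorial : ℚ) = m := by
  classical
  refine ⟨fun h => ?_, fun h => Nat.find_min' _ h⟩
  obtain ⟨m, hm⟩ := x.factorialLevel_spec
  obtain ⟨c, hc⟩ := Nat.factorial_dvd_factorial h
  refine ⟨m * c, ?_⟩
  rw [hc]
  push_cast
  rw [← hm, mul_assoc]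

theorem Rat.factorialLevel_add_le (x y : ℚ) :
    (x + y).factorialLevel ≤ max x.factorialLevel y.factorialLevel := by
  obtain ⟨a, ha⟩ := Rat.factorialLevel_le_iff.1 (le_max_left x.factorialLevel y.factorialLevel)
  obtain ⟨b, hb⟩ := Rat.factorialLevel_le_iff.1 (le_max_right x.factorialLevel y.factorialLevel)
  exact Rat.factorialLevel_le_iff.2 ⟨a + b, by rw [add_mul, ha, hb]; push_cast; rfl⟩

theorem Rat.factorialLevel_int_mul_le (n : ℤ) (x : ℚ) :
    (n * x).factorialLevel ≤ x.factorialLevel := by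
  obtain ⟨a, ha⟩ := x.factorialLevel_spec
  exact Rat.factorialLevel_le_iff.2 ⟨n * a, by rw [mul_assoc, ha]; push_cast; rfl⟩

theorem Rat.factorialLevel_neg (x : ℚ) : (-x).factorialLevel = x.factorialLevel := by
  have h (y : ℚ) : (-y).factorialLevel ≤ y.factorialLevel := by
    simpa using Rat.factorialLevel_int_mul_le (-1) y
  exact le_antisymm (h x) (by simpa using h (-x))

/-- The rapidly growing penalty attached to the factorial level `k`. -/
def levelPenalty (k : ℕ) : ℝ := 4 ^ k * (k.factorial : ℝ) ^ 3

theorem one_le_levelPenalty (k : ℕ) : 1 ≤ levelPenalty k :=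
  one_le_mul_of_one_le_of_one_le (one_le_pow₀ (by norm_num))
    (one_le_pow₀ (by exact_mod_cast Nat.one_le_iff_ne_zero.2 k.factorial_ne_zero))

theorem levelPenalty_mono : Monotone levelPenalty := by
  intro a b h
  unfold levelPenalty
  gcongr
  norm_num

/-- A length function on `ℚ` whose inverse square is summable. -/
noncomputable def Rat.length (x : ℚ) : ℝ := levelPenalty x.factorialLevel + |(x : ℝ)|

theorem Rat.length_pos (x : ℚ) : 0 < x.length :=
  add_pos_of_pos_of_nonneg (zero_lt_one.trans_le (one_le_levelPenalty _)) (abs_nonneg _)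

theorem Rat.length_neg (x : ℚ) : (-x).length = x.length := by
  simp [Rat.length, Rat.factorialLevel_neg]

theorem Rat.length_add_le (x y : ℚ) : (x + y).length ≤ x.length + y.length := by
  have h : levelPenalty (x + y).factorialLevel ≤
      levelPenalty x.factorialLevel + levelPenalty y.factorialLevel := by
    have hx := one_le_levelPenalty x.factorialLevel
    have hy := one_le_levelPenalty y.factorialLevel
    refine (levelPenalty_mono (Rat.factorialLevel_add_le x y)).trans ?_
    rw [levelPenalty_mono.map_max]
    exact max_le (by linarith) (by linarith)
  have h' := abs_add_le (x : ℝ) y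
  simp only [Rat.length]
  push_cast
  linarith

theorem Rat.length_nat_mul_le {n : ℕ} (hn : 1 ≤ n) (x : ℚ) :
    ((n : ℚ) * x).length ≤ n * x.length := by
  have h := levelPenalty_mono (Rat.factorialLevel_int_mul_le n x)
  have hp := one_le_levelPenalty x.factorialLevel
  have hn' : (1 : ℝ) ≤ n := by exact_mod_cast hn
  simp only [Rat.length, Int.cast_natCast] at h ⊢
  push_cast
  rw [abs_mul, Nat.abs_cast]
  nlinarith

theorem one_div_sq_levelPenalty_add_le (k : ℕ) (m : ℤ) :
    1 / (levelPenalty k + |(m : ℝ)| / k.factorial) ^ 2 ≤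
      (1 / 2) ^ k * (1 / |(m : ℝ) + 1 / 2| ^ (3 / 2 : ℝ)) := by
  have hK : (1 : ℝ) ≤ k.factorial := by
    exact_mod_cast Nat.one_le_iff_ne_zero.2 k.factorial_ne_zero
  set K : ℝ := (k.factorial : ℝ)
  have hm : 0 < |(m : ℝ) + 1 / 2| := by
    refine abs_pos.2 fun h => ?_
    have h2 : (2 * m + 1 : ℝ) = 0 := by linarith
    norm_cast at h2
    omega
  set B : ℝ := (2 ^ k * K ^ 2) ^ 2 with hB
  have hroot : (1 : ℝ) ≤ 2 ^ k * K ^ 2 :=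
    one_le_mul_of_one_le_of_one_le (one_le_pow₀ (by norm_num)) (one_le_pow₀ hK)
  have hB1 : 1 ≤ B := one_le_pow₀ hroot
  have hlen : levelPenalty k + |(m : ℝ)| / K = (B + |(m : ℝ)|) / K := by
    have h4 : (4 : ℝ) ^ k = (2 ^ k) ^ 2 := by rw [← pow_mul, mul_comm, pow_mul]; norm_num
    simp only [levelPenalty, hB, h4]
    change (2 ^ k) ^ 2 * K ^ 3 + _ = _
    field_simp
  have hmB : |(m : ℝ) + 1 / 2| ≤ B + |(m : ℝ)| := by
    have := abs_add_le (m : ℝ) (1 / 2)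
    rw [abs_of_pos (by norm_num : (0 : ℝ) < 1 / 2)] at this
    linarith
  have key : 2 ^ k * K ^ 2 * |(m : ℝ) + 1 / 2| ^ (3 / 2 : ℝ) ≤ (B + |(m : ℝ)|) ^ 2 := by
    have hs : 2 ^ k * K ^ 2 = B ^ (1 / 2 : ℝ) := by
      rw [hB, ← Real.sqrt_eq_rpow, Real.sqrt_sq (by linarith)]
    have hsq : (B + |(m : ℝ)|) ^ 2 =
        (B + |(m : ℝ)|) ^ (1 / 2 : ℝ) * (B + |(m : ℝ)|) ^ (3 / 2 : ℝ) := by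
      rw [← Real.rpow_add (by positivity), ← Real.rpow_natCast]
      norm_num
    rw [hs, hsq]
    gcongr
    linarith [abs_nonneg (m : ℝ)]
  rw [hlen, one_div_pow, one_div_mul_one_div]
  refine one_div_le_one_div_of_le (by positivity) ?_
  rw [div_pow, le_div_iff₀ (by positivity)]
  linarith

theorem Rat.summable_one_div_length_sq : Summable fun x : ℚ => 1 / x.length ^ 2 := by
  choose num hnum using Rat.factorialLevel_spec
  have hinj : Function.Injective fun x : ℚ => (x.factorialLevel, num x) := by
    intro x y h
    simp only [Prod.mk.injEq] at h
    have hx := hnum x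
    rw [h.1, h.2, ← hnum y] at hx
    exact mul_right_cancel₀ (by exact_mod_cast Nat.factorial_ne_zero _) hx
  have hprod : Summable fun p : ℕ × ℤ =>
      (1 / 2 : ℝ) ^ p.1 * (1 / |(p.2 : ℝ) + 1 / 2| ^ (3 / 2 : ℝ)) :=
    summable_geometric_two.mul_of_nonneg
      ((Real.summable_one_div_int_add_rpow (1 / 2) (3 / 2)).2 (by norm_num))
      (fun _ => by positivity) (fun _ => by positivity)
  refine (hprod.comp_injective hinj).of_nonneg_of_le (fun x => by positivity) fun x => ?_
  have hx : |(x : ℝ)| = |(num x : ℝ)| / x.factorialLevel.factorial := by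
    have h0 : (0 : ℝ) < x.factorialLevel.factorial := by
      exact_mod_cast Nat.factorial_pos _
    have h : (x : ℝ) * x.factorialLevel.factorial = num x := by exact_mod_cast hnum x
    rw [eq_div_iff h0.ne', ← h, abs_mul, abs_of_pos h0]
  rw [Rat.length, hx]
  exact one_div_sq_levelPenalty_add_le _ _

/-- If `1 / v` is subadditive up to a constant `K`, then so is the convolution square of `v`
bounded by `v` up to the constant `2 * K * ∑' y, v y`. -/
theorem summable_conv_and_tsum_conv_le {G : Type*} [AddCommGroup G] {v : G → ℝ} {K : ℝ}
    (hv : Summable v) (hv0 : ∀ x, 0 ≤ v x)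
    (h : ∀ x y, v y * v (x - y) ≤ K * v x * (v y + v (x - y))) (x : G) :
    Summable (fun y => v y * v (x - y)) ∧
      ∑' y, v y * v (x - y) ≤ 2 * K * (∑' y, v y) * v x := by
  have hrefl : Summable fun y => v (x - y) := (Equiv.subLeft x).summable_iff.2 hv
  have hbound := (hv.add hrefl).mul_left (K * v x)
  have hsum : Summable fun y => v y * v (x - y) :=
    hbound.of_nonneg_of_le (fun y => mul_nonneg (hv0 _) (hv0 _)) (h x)
  refine ⟨hsum, (hsum.tsum_le_tsum (h x) hbound).trans_eq ?_⟩
  have hrefl_tsum : ∑' y, v (x - y) = ∑' y, v y := (Equiv.subLeft x).tsum_eq v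
  rw [tsum_mul_left, hv.tsum_add hrefl, hrefl_tsum]
  ring

theorem Rat.one_div_length_sq_mul_le (x y : ℚ) :
    1 / y.length ^ 2 * (1 / (x - y).length ^ 2) ≤
      2 * (1 / x.length ^ 2) * (1 / y.length ^ 2 + 1 / (x - y).length ^ 2) := by
  have h := Rat.length_add_le y (x - y)
  rw [add_sub_cancel] at h
  have hx := x.length_pos
  have hy := y.length_pos
  have hz := (x - y).length_pos
  have hsq : x.length ^ 2 ≤ 2 * (y.length ^ 2 + (x - y).length ^ 2) := by
    nlinarith [sq_nonneg (y.length - (x - y).length)]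
  have hrw : 2 * (1 / x.length ^ 2) * (1 / y.length ^ 2 + 1 / (x - y).length ^ 2) =
      1 / y.length ^ 2 * (1 / (x - y).length ^ 2) *
        (2 * (y.length ^ 2 + (x - y).length ^ 2) / x.length ^ 2) := by
    field_simp
    ring
  rw [hrw]
  exact le_mul_of_one_le_right (by positivity) ((one_le_div (by positivity)).2 hsq)


/-- On the discrete group `ℚ` there is a function `u` which is positive
(a), satisfies `u*u ≤ u` pointwise with the convolution sum converging (b), is even (c),
and `1/u(nq)` grows at most quadratically in `n` for every `q` (d). -/
theorem exists_weight_rationals :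
    ∃ u : ℚ → ℝ,
      (∀ x, 0 < u x) ∧
      (∀ x : ℚ, Summable (fun y : ℚ => u y * u (x - y)) ∧
        ∑' y : ℚ, u y * u (x - y) ≤ u x) ∧
      (∀ x, u (-x) = u x) ∧
      (∀ q : ℚ, ∃ C > (0 : ℝ), ∀ n : ℕ, 1 ≤ n →
        1 / u ((n : ℚ) * q) ≤ C * (n : ℝ) ^ 2) := by
  set v : ℚ → ℝ := fun x => 1 / x.length ^ 2 with hv
  have hpos (x : ℚ) : 0 < v x := one_div_pos.2 (pow_pos x.length_pos 2)
  have hS : 0 < ∑' x, v x :=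
    Rat.summable_one_div_length_sq.tsum_pos (fun x => (hpos x).le) 0 (hpos 0)
  set S := ∑' x, v x
  have hconv := summable_conv_and_tsum_conv_le Rat.summable_one_div_length_sq
    (fun x => (hpos x).le) Rat.one_div_length_sq_mul_le
  have hmul (x y : ℚ) : v y / (4 * S) * (v (x - y) / (4 * S)) =
      (1 / (4 * S) ^ 2) * (v y * v (x - y)) := by
    field_simp
  refine ⟨fun x => v x / (4 * S), fun x => div_pos (hpos x) (by positivity), fun x => ?_,
    fun x => by simp only [hv, Rat.length_neg], fun q => ?_⟩
  · simp only [hmul]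
    refine ⟨(hconv x).1.mul_left _, ?_⟩
    rw [tsum_mul_left]
    calc 1 / (4 * S) ^ 2 * ∑' y, v y * v (x - y)
        ≤ 1 / (4 * S) ^ 2 * (2 * 2 * S * v x) := by gcongr; exact (hconv x).2
      _ = v x / (4 * S) := by field_simp; ring
  · have hq := q.length_pos
    refine ⟨4 * S * q.length ^ 2, by positivity, fun n hn => ?_⟩
    have hle := pow_le_pow_left₀ ((n : ℚ) * q).length_pos.le (Rat.length_nat_mul_le hn q) 2
    calc 1 / (v (n * q) / (4 * S)) = 4 * S * ((n : ℚ) * q).length ^ 2 := by simp [hv]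
      _ ≤ 4 * S * (n * q.length) ^ 2 := by gcongr
      _ = 4 * S * q.length ^ 2 * (n : ℝ) ^ 2 := by ring
end

section
/- Define σ : ℤ → ℝ by σ(n) = 1/max(1,|n|)². Then there exists a constant C₂ > 0 such that for every m ∈ ℤ, Σ_{n ∈ ℤ} σ(n) σ(m−n) ≤ C₂ σ(m). -/
theorem summable_one_div_max_one_abs_sq :
    Summable fun n : ℤ => 1 / (max 1 |(n : ℝ)|) ^ 2 := by
  have h := Real.summable_one_div_int_pow.mpr one_lt_two
  refine h.congr_cofinite ?_
  filter_upwards [(Set.finite_singleton (0 : ℤ)).compl_mem_cofinite] with n hn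
  have h1 : (1 : ℝ) ≤ |(n : ℝ)| := by
    exact_mod_cast Int.one_le_abs (by simpa using hn)
  rw [max_eq_right h1, sq_abs]

theorem one_div_sq_mul_one_div_sq_le {a b c : ℝ} (ha : 0 < a) (hb : 0 < b) (hc : 0 < c)
    (h : c ≤ a + b) :
    1 / a ^ 2 * (1 / b ^ 2) ≤ 2 * (1 / c ^ 2) * (1 / a ^ 2 + 1 / b ^ 2) := by
  have h2 : c ^ 2 ≤ 2 * (a ^ 2 + b ^ 2) := by nlinarith [sq_nonneg (a - b)]
  have e : 2 * (1 / c ^ 2) * (1 / a ^ 2 + 1 / b ^ 2)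
      = 1 / a ^ 2 * (1 / b ^ 2) * (2 * (a ^ 2 + b ^ 2) / c ^ 2) := by
    field_simp
    ring
  rw [e]
  exact le_mul_of_one_le_right (by positivity) ((one_le_div (by positivity)).mpr h2)

theorem max_one_abs_le_add (x y : ℝ) : max 1 |x| ≤ max 1 |y| + max 1 |x - y| := by
  have h1 := le_max_left 1 |y|
  have h2 := le_max_right 1 |y|
  have h3 := le_max_left 1 |x - y|
  have h4 := le_max_right 1 |x - y|
  have h5 := abs_add_le y (x - y)
  rw [add_sub_cancel] at h5
  exact max_le (by linarith) (by linarith)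

/-- For `σ(n) = 1/max(1,|n|)²` on `ℤ` there is a constant `C₂ > 0`
with `Σ_n σ(n)σ(m−n) ≤ C₂ σ(m)` for every `m ∈ ℤ`. -/
theorem sigma_convolution_bound
    (σ : ℤ → ℝ) (hσ : ∀ n : ℤ, σ n = 1 / (max 1 (|n| : ℝ)) ^ 2) :
    ∃ C₂ > (0 : ℝ), ∀ m : ℤ,
      Summable (fun n : ℤ => σ n * σ (m - n)) ∧
      ∑' n : ℤ, σ n * σ (m - n) ≤ C₂ * σ m := by
  have hpos : ∀ n, 0 < σ n := fun n => by rw [hσ]; positivity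
  have hs : Summable σ := summable_one_div_max_one_abs_sq.congr fun n => (hσ n).symm
  have hle : ∀ m n, σ n * σ (m - n) ≤ 2 * σ m * (σ n + σ (m - n)) := fun m n => by
    simp only [hσ, Int.cast_sub]
    exact one_div_sq_mul_one_div_sq_le (by positivity) (by positivity) (by positivity)
      (max_one_abs_le_add _ _)
  refine ⟨4 * ∑' n, σ n, mul_pos four_pos (hs.tsum_pos (fun n => (hpos n).le) 0 (hpos 0)),
    fun m => ?_⟩
  have hs' : Summable fun n => σ (m - n) := (Equiv.subLeft m).summable_iff.mpr hs
  have heq : ∑' n, σ (m - n) = ∑' n, σ n := (Equiv.subLeft m).tsum_eq σ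
  have hdom := (hs.add hs').mul_left (2 * σ m)
  have hsum : Summable fun n => σ n * σ (m - n) :=
    .of_nonneg_of_le (fun n => (mul_pos (hpos n) (hpos _)).le) (hle m) hdom
  refine ⟨hsum, (hsum.tsum_le_tsum (hle m) hdom).trans_eq ?_⟩
  rw [tsum_mul_left, hs.tsum_add hs', heq]
  ring
end

section
/- Let (G_j)_{j ∈ ℕ} be discrete abelian groups, and for each j let u_j : G_j → ℝ satisfy: (a) u_j > 0; (b) Σ_{y ∈ G_j} u_j(y) u_j(x−y) ≤ u_j(x) for all x ∈ G_j; (c) u_j(−x) = u_j(x); (d) for every x ∈ G_j there exist C > 0 and d ∈ ℕ with 1/u_j(nx) ≤ C n^d for all n ≥ 1. Then on the direct sum G = ⊕_{j ∈ ℕ} G_j (elements of the product with finitely many nonzero coordinates) there exists a function u : G → ℝ satisfying the same four conditions (a)–(d). -/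
open DirectSum

open scoped ENNReal

section

variable {G : ℕ → Type*} [∀ j, AddCommGroup (G j)]

/-- A sum over the elements of `⨁ j, G j` supported below `m` of products of functions of the
coordinates is at most the product of the sums. -/
lemma tsum_ite_prod_range_le (m : ℕ) (F : ∀ j, G j → ℝ≥0∞) :
    (∑' y : ⨁ j, G j, open Classical in
      if ∀ j, m ≤ j → y j = 0 then ∏ j ∈ Finset.range m, F j (y j) else 0) ≤
      ∏ j ∈ Finset.range m, ∑' z, F j z := by
  classical
  rw [ENNReal.tsum_eq_iSup_sum]
  refine iSup_le fun T => ?_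
  rw [← Finset.sum_filter]
  set T' := T.filter fun y => ∀ j, m ≤ j → y j = 0 with hT'
  let r : (⨁ j, G j) → ∀ i : Fin m, G i := fun y i => y i
  have hr : Set.InjOn r T' := by
    intro y hy z hz hyz
    simp only [hT', Finset.coe_filter, Set.mem_ofPred_eq] at hy hz
    refine DFinsupp.ext fun j => ?_
    by_cases hj : j < m
    · exact congrFun hyz ⟨j, hj⟩
    · exact (hy.2 j (not_lt.1 hj)).trans (hz.2 j (not_lt.1 hj)).symm
  calc ∑ y ∈ T', ∏ j ∈ Finset.range m, F j (y j)
      = ∑ y ∈ T', ∏ i : Fin m, F i (r y i) :=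
        Finset.sum_congr rfl fun y _ => Finset.prod_range fun j => F j (y j)
    _ = ∑ p ∈ T'.image r, ∏ i : Fin m, F i (p i) :=
        (Finset.sum_image (f := fun p => ∏ i : Fin m, F i (p i)) hr).symm
    _ ≤ ∑ p ∈ Fintype.piFinset fun i : Fin m => T'.image fun y => y (i : ℕ),
          ∏ i : Fin m, F i (p i) := by
        refine Finset.sum_le_sum_of_subset fun p hp => ?_
        obtain ⟨y, hy, rfl⟩ := Finset.mem_image.1 hp
        exact Fintype.mem_piFinset.2 fun i => Finset.mem_image_of_mem _ hy
    _ = ∏ i : Fin m, ∑ z ∈ T'.image fun y => y (i : ℕ), F i z :=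
        (Finset.prod_univ_sum _ _).symm
    _ ≤ ∏ i : Fin m, ∑' z, F i z :=
        Finset.prod_le_prod' fun i _ => ENNReal.sum_le_tsum _
    _ = ∏ j ∈ Finset.range m, ∑' z, F j z :=
        (Finset.prod_range fun j => ∑' z, F j z).symm

/-- The function `u j` if `j < k`, and the indicator function of `0` otherwise. -/
noncomputable def truncatedWeight (u : ∀ j, G j → ℝ) (k j : ℕ) (z : G j) : ℝ≥0∞ :=
  open Classical in if j < k then ENNReal.ofReal (u j z) else if z = 0 then 1 else 0

/-- The product of the functions `u j` over `j < k`, extended by zero from the elements supported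
below `k` to the whole direct sum. -/
noncomputable def partialWeight (u : ∀ j, G j → ℝ) (k : ℕ) (x : ⨁ j, G j) : ℝ≥0∞ :=
  open Classical in
    if ∀ j, k ≤ j → x j = 0 then ∏ j ∈ Finset.range k, ENNReal.ofReal (u j (x j)) else 0

/-- A combination of the partial weights with geometrically decreasing coefficients. -/
noncomputable def directSumWeight (u : ∀ j, G j → ℝ) (x : ⨁ j, G j) : ℝ≥0∞ :=
  ∑' k : ℕ, 2⁻¹ ^ k * 4⁻¹ * partialWeight u k x

lemma tsum_two_inv_pow_mul_four_inv : ∑' k : ℕ, (2⁻¹ : ℝ≥0∞) ^ k * 4⁻¹ = 2⁻¹ := by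
  rw [ENNReal.tsum_mul_right, ENNReal.tsum_geometric, ENNReal.one_sub_inv_two, inv_inv,
    show (4 : ℝ≥0∞) = 2 * 2 by norm_num, ENNReal.mul_inv (by simp) (by simp), ← mul_assoc,
    ENNReal.mul_inv_cancel (by simp) (by simp), one_mul]

variable {u : ∀ j, G j → ℝ}

lemma partialWeight_eq_of_le {k m : ℕ} (hkm : k ≤ m) (x : ⨁ j, G j) :
    partialWeight u k x = open Classical in
      if ∀ j, m ≤ j → x j = 0 then ∏ j ∈ Finset.range m, truncatedWeight u k j (x j) else 0 := by
  classical
  unfold partialWeight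
  by_cases hk : ∀ j, k ≤ j → x j = 0
  · rw [if_pos hk, if_pos fun j hj => hk j (hkm.trans hj),
      ← Finset.prod_subset (Finset.range_mono hkm)]
    · exact Finset.prod_congr rfl fun j hj => by
        simp [truncatedWeight, Finset.mem_range.1 hj]
    · intro j _ hj
      have hj' : ¬ j < k := by simpa using hj
      simp [truncatedWeight, hj', hk j (not_lt.1 hj')]
  · rw [if_neg hk]
    split_ifs with hm
    · push Not at hk
      obtain ⟨j, hkj, hj⟩ := hk
      have hjm : j < m := by
        by_contra h
        exact hj (hm j (not_lt.1 h))
      refine (Finset.prod_eq_zero (Finset.mem_range.2 hjm) ?_).symm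
      simp [truncatedWeight, hj, hkj.not_gt]
    · rfl

lemma tsum_ofReal_mul_le (ha : ∀ j, ∀ x : G j, 0 < u j x)
    (hb : ∀ j, ∀ x : G j, Summable (fun y : G j => u j y * u j (x - y)) ∧
      ∑' y : G j, u j y * u j (x - y) ≤ u j x) (j : ℕ) (x : G j) :
    ∑' y, ENNReal.ofReal (u j y) * ENNReal.ofReal (u j (x - y)) ≤ ENNReal.ofReal (u j x) := by
  simp_rw [← ENNReal.ofReal_mul (ha j _).le]
  rw [← ENNReal.ofReal_tsum_of_nonneg (fun y => (mul_pos (ha j _) (ha j _)).le) (hb j x).1]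
  exact ENNReal.ofReal_le_ofReal (hb j x).2

lemma tsum_truncatedWeight_mul_le
    (hconv : ∀ j, ∀ x : G j,
      ∑' y, ENNReal.ofReal (u j y) * ENNReal.ofReal (u j (x - y)) ≤ ENNReal.ofReal (u j x))
    (k l j : ℕ) (x : G j) :
    ∑' y, truncatedWeight u k j y * truncatedWeight u l j (x - y) ≤
      truncatedWeight u (max k l) j x := by
  classical
  by_cases hk : j < k
  · by_cases hl : j < l
    · simpa [truncatedWeight, hk, hl] using hconv j x
    · rw [tsum_eq_single x]
      · simp [truncatedWeight, hk, hl]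
      · intro y hy
        simp [truncatedWeight, hl, sub_eq_zero, hy.symm]
  · rw [tsum_eq_single 0]
    · by_cases hl : j < l <;> simp [truncatedWeight, hk, hl]
    · intro y hy
      simp [truncatedWeight, hk, hy]

lemma tsum_partialWeight_mul_le
    (hconv : ∀ j, ∀ x : G j,
      ∑' y, ENNReal.ofReal (u j y) * ENNReal.ofReal (u j (x - y)) ≤ ENNReal.ofReal (u j x))
    (k l : ℕ) (x : ⨁ j, G j) :
    ∑' y, partialWeight u k y * partialWeight u l (x - y) ≤ partialWeight u (max k l) x := by
  classical
  simp_rw [partialWeight_eq_of_le (le_max_left k l), partialWeight_eq_of_le (le_max_right k l),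
    partialWeight_eq_of_le (le_refl (max k l))]
  generalize hm : max k l = m
  by_cases hx : ∀ j, m ≤ j → x j = 0
  · rw [if_pos hx]
    calc _ ≤ ∑' y : ⨁ j, G j, if ∀ j, m ≤ j → y j = 0 then ∏ j ∈ Finset.range m,
            truncatedWeight u k j (y j) * truncatedWeight u l j (x j - y j) else 0 := by
          refine ENNReal.tsum_le_tsum fun y => ?_
          by_cases hy : ∀ j, m ≤ j → y j = 0
          · rw [if_pos hy, if_pos hy, Finset.prod_mul_distrib]
            gcongr
            split_ifs
            · simp
            · simp
          · simp [if_neg hy]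
      _ ≤ _ := tsum_ite_prod_range_le m fun j z =>
          truncatedWeight u k j z * truncatedWeight u l j (x j - z)
      _ ≤ _ := Finset.prod_le_prod' fun j _ => by
          subst hm
          exact tsum_truncatedWeight_mul_le hconv k l j (x j)
  · rw [if_neg hx, nonpos_iff_eq_zero, ENNReal.tsum_eq_zero]
    intro y
    by_cases hy : ∀ j, m ≤ j → y j = 0
    · rw [if_neg (c := ∀ j, m ≤ j → (x - y) j = 0), mul_zero]
      intro h
      refine hx fun j hj => ?_
      simpa [hy j hj] using h j hj
    · rw [if_neg hy, zero_mul]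

lemma partialWeight_max_le (k l : ℕ) (x : ⨁ j, G j) :
    partialWeight u (max k l) x ≤ partialWeight u k x + partialWeight u l x := by
  rcases max_choice k l with h | h <;> rw [h]
  · exact le_self_add
  · exact le_add_self

lemma tsum_directSumWeight_mul_le
    (hconv : ∀ j, ∀ x : G j,
      ∑' y, ENNReal.ofReal (u j y) * ENNReal.ofReal (u j (x - y)) ≤ ENNReal.ofReal (u j x))
    (x : ⨁ j, G j) :
    ∑' y, directSumWeight u y * directSumWeight u (x - y) ≤ directSumWeight u x := by
  set c : ℕ → ℝ≥0∞ := fun k => 2⁻¹ ^ k * 4⁻¹ with hc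
  have hW : ∀ y, directSumWeight u y = ∑' k, c k * partialWeight u k y := fun _ => rfl
  have hsum : ∑' k, c k = 2⁻¹ := tsum_two_inv_pow_mul_four_inv
  calc ∑' y, directSumWeight u y * directSumWeight u (x - y)
      = ∑' y, ∑' k, ∑' l, c k * c l * (partialWeight u k y * partialWeight u l (x - y)) := by
        simp_rw [hW, ← ENNReal.tsum_mul_right, ← ENNReal.tsum_mul_left]
        refine tsum_congr fun y => tsum_congr fun k => tsum_congr fun l => by ring
    _ = ∑' k, ∑' l, c k * c l * ∑' y, partialWeight u k y * partialWeight u l (x - y) := by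
        rw [ENNReal.tsum_comm]
        refine tsum_congr fun k => ?_
        rw [ENNReal.tsum_comm]
        exact tsum_congr fun l => ENNReal.tsum_mul_left
    _ ≤ ∑' k, ∑' l, c k * c l * (partialWeight u k x + partialWeight u l x) := by
        gcongr with k l
        exact (tsum_partialWeight_mul_le hconv k l x).trans (partialWeight_max_le k l x)
    _ = ∑' k, ∑' l, (c k * partialWeight u k x * c l + c k * (c l * partialWeight u l x)) := by
        refine tsum_congr fun k => tsum_congr fun l => by ring
    _ = directSumWeight u x * 2⁻¹ + 2⁻¹ * directSumWeight u x := by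
        simp_rw [ENNReal.tsum_add, ENNReal.tsum_mul_left, ENNReal.tsum_mul_right, hsum, hW]
    _ = directSumWeight u x := by
        rw [mul_comm, ← add_mul, ENNReal.inv_two_add_inv_two, one_mul]

lemma le_one_of_tsum_mul_le {A : Type*} [AddCommGroup A] {v : A → ℝ} (ha : ∀ x, 0 < v x)
    (hb : ∀ x, Summable (fun y => v y * v (x - y)) ∧ ∑' y, v y * v (x - y) ≤ v x)
    (hc : ∀ x, v (-x) = v x) (x : A) : v x ≤ 1 := by
  have key : ∀ y, v y * v y ≤ v 0 := fun y => by
    have h := (hb 0).1.le_tsum y fun z _ => (mul_pos (ha z) (ha _)).le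
    rw [zero_sub, hc] at h
    exact h.trans (hb 0).2
  have h0 : v 0 ≤ 1 := le_of_mul_le_mul_right (by simpa using key 0) (ha 0)
  nlinarith [key x, ha x]

lemma directSumWeight_le (hu : ∀ j, ∀ x : G j, u j x ≤ 1) (x : ⨁ j, G j) :
    directSumWeight u x ≤ 2⁻¹ := by
  rw [← tsum_two_inv_pow_mul_four_inv]
  refine ENNReal.tsum_le_tsum fun k => mul_le_of_le_one_right' ?_
  unfold partialWeight
  split_ifs
  · exact Finset.prod_le_one' fun j _ => by simpa using hu j (x j)
  · exact zero_le_one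

lemma directSumWeight_neg (hc : ∀ j, ∀ x : G j, u j (-x) = u j x) (x : ⨁ j, G j) :
    directSumWeight u (-x) = directSumWeight u x := by
  classical
  have hneg : ∀ j, (-x) j = -x j := fun j => DFinsupp.neg_apply x j
  unfold directSumWeight partialWeight
  refine tsum_congr fun k => congrArg _ (if_congr ?_ ?_ rfl)
  · simp only [hneg, neg_eq_zero]
  · simp only [hneg, hc]

lemma exists_forall_le_apply_eq_zero (x : ⨁ j, G j) : ∃ k, ∀ j, k ≤ j → x j = 0 := by
  classical
  obtain ⟨k, hk⟩ := (DFinsupp.support x).exists_nat_subset_range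
  exact ⟨k, fun j hj => by
    by_contra h
    have := Finset.mem_range.1 (hk (DFinsupp.mem_support_toFun x j |>.2 h))
    omega⟩

lemma le_toReal_directSumWeight (ha : ∀ j, ∀ x : G j, 0 < u j x)
    (hu : ∀ j, ∀ x : G j, u j x ≤ 1) {k : ℕ} {x : ⨁ j, G j} (hx : ∀ j, k ≤ j → x j = 0) :
    2⁻¹ ^ k * 4⁻¹ * ∏ j ∈ Finset.range k, u j (x j) ≤ (directSumWeight u x).toReal := by
  have hfin : directSumWeight u x ≠ ∞ :=
    ((directSumWeight_le hu x).trans_lt (by simp)).ne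
  have h := ENNReal.toReal_mono hfin
    (ENNReal.le_tsum (f := fun k => 2⁻¹ ^ k * 4⁻¹ * partialWeight u k x) k)
  simpa [partialWeight, if_pos hx, ENNReal.toReal_prod, ENNReal.toReal_ofReal (ha _ _).le] using h

end


/-- If each discrete abelian group `G j` carries a function `u j`
satisfying (a) positivity, (b) `u*u ≤ u` (with converging convolution sums),
(c) evenness and (d) polynomial decay along multiples, then so does the direct sum
`⊕_j G j`. -/
theorem exists_weight_direct_sum
    (G : ℕ → Type*) [∀ j, AddCommGroup (G j)]
    (u : ∀ j, G j → ℝ)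
    (ha : ∀ j, ∀ x : G j, 0 < u j x)
    (hb : ∀ j, ∀ x : G j, Summable (fun y : G j => u j y * u j (x - y)) ∧
      ∑' y : G j, u j y * u j (x - y) ≤ u j x)
    (hc : ∀ j, ∀ x : G j, u j (-x) = u j x)
    (hd : ∀ j, ∀ x : G j, ∃ C > (0 : ℝ), ∃ d : ℕ, ∀ n : ℕ, 1 ≤ n →
      1 / u j (n • x) ≤ C * (n : ℝ) ^ d) :
    ∃ U : (⨁ j, G j) → ℝ,
      (∀ x, 0 < U x) ∧
      (∀ x : ⨁ j, G j, Summable (fun y : ⨁ j, G j => U y * U (x - y)) ∧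
        ∑' y : ⨁ j, G j, U y * U (x - y) ≤ U x) ∧
      (∀ x, U (-x) = U x) ∧
      (∀ x : ⨁ j, G j, ∃ C > (0 : ℝ), ∃ d : ℕ, ∀ n : ℕ, 1 ≤ n →
        1 / U (n • x) ≤ C * (n : ℝ) ^ d) := by
  have hu : ∀ j, ∀ x : G j, u j x ≤ 1 := fun j => le_one_of_tsum_mul_le (ha j) (hb j) (hc j)
  have hfin : ∀ x, directSumWeight u x ≠ ∞ := fun x =>
    ((directSumWeight_le hu x).trans_lt (by simp)).ne
  refine ⟨fun x => (directSumWeight u x).toReal, fun x => ?_, fun x => ?_, fun x => ?_,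
    fun x => ?_⟩
  · obtain ⟨k, hk⟩ := exists_forall_le_apply_eq_zero x
    have := Finset.prod_pos (s := Finset.range k) fun j _ => ha j (x j)
    exact lt_of_lt_of_le (by positivity) (le_toReal_directSumWeight ha hu hk)
  · have h := tsum_directSumWeight_mul_le (tsum_ofReal_mul_le ha hb) x
    simp only [← ENNReal.toReal_mul]
    refine ⟨ENNReal.summable_toReal (ne_top_of_le_ne_top (hfin x) h), ?_⟩
    rw [← ENNReal.tsum_toReal_eq fun y => ENNReal.mul_ne_top (hfin _) (hfin _)]
    exact ENNReal.toReal_mono (hfin x) h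
  · simp only [directSumWeight_neg hc]
  · obtain ⟨k, hk⟩ := exists_forall_le_apply_eq_zero x
    choose C hC d hCd using fun j => hd j (x j)
    have hCpos := Finset.prod_pos (s := Finset.range k) fun j _ => hC j
    refine ⟨2 ^ k * 4 * ∏ j ∈ Finset.range k, C j, by positivity,
      ∑ j ∈ Finset.range k, d j, fun n hn => ?_⟩
    have hcoord : ∀ j, (n • x) j = n • x j := fun j => DFinsupp.smul_apply n x j
    have hle := le_toReal_directSumWeight ha hu (x := n • x) (k := k) fun j hj => by
      rw [hcoord, hk j hj, smul_zero]
    simp only [hcoord] at hle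
    have hpos := Finset.prod_pos (s := Finset.range k) fun j _ => ha j (n • x j)
    calc 1 / (directSumWeight u (n • x)).toReal
        ≤ 1 / (2⁻¹ ^ k * 4⁻¹ * ∏ j ∈ Finset.range k, u j (n • x j)) :=
          one_div_le_one_div_of_le (by positivity) hle
      _ = 2 ^ k * 4 * ∏ j ∈ Finset.range k, 1 / u j (n • x j) := by
          simp [Finset.prod_inv_distrib, mul_comm]
      _ ≤ 2 ^ k * 4 * ∏ j ∈ Finset.range k, C j * (n : ℝ) ^ d j := by
          gcongr with j hj
          · exact fun j _ => (one_div_pos.2 (ha j _)).le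
          · exact hCd j n hn
      _ = 2 ^ k * 4 * (∏ j ∈ Finset.range k, C j) * (n : ℝ) ^ ∑ j ∈ Finset.range k, d j := by
          rw [Finset.prod_mul_distrib, Finset.prod_pow_eq_pow_sum, ← mul_assoc]
end

section
/- Set ε₁ = e^{−2}/8 and for a finite set s of positive integers define a_s = ε₁ / (Σ_{j ∈ s} j!) for s ≠ ∅ and a_∅ = ε₁. Then 0 < a_s ≤ 1 for all finite s, a_{s ∪ v} ≤ a_s for all finite s, v, and for every finite set s of positive integers, Σ_{v ⊆ s} a_v a_{s∖v} / a_s ≤ 1/4 (the sum ranging over all subsets v of s, including v = ∅ and v = s). -/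
open Finset in
/-- The reciprocals of the factorial sums (read as `1` on `∅`) over all sets of positive integers
up to `N` are dominated by a partial sum of the exponential series at `2`. -/
theorem sum_powerset_Icc_inv_factorial_sum_le (N : ℕ) :
    ∑ v ∈ (Icc 1 N).powerset, (max 1 (∑ j ∈ v, (Nat.factorial j : ℝ)))⁻¹ ≤
      ∑ k ∈ range (N + 1), (2 : ℝ) ^ k / (Nat.factorial k : ℝ) := by
  induction N with
  | zero => simp
  | succ N ih =>
    rw [sum_range_succ, ← insert_Icc_right_eq_Icc_add_one (by omega : 1 ≤ N + 1),
      sum_powerset_insert (by simp)]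
    refine add_le_add ih ?_
    have hterm : ∀ v ∈ (Icc 1 N).powerset,
        (max 1 (∑ j ∈ insert (N + 1) v, (Nat.factorial j : ℝ)))⁻¹ ≤
          (Nat.factorial (N + 1) : ℝ)⁻¹ := fun v _ =>
      inv_anti₀ (by positivity) (le_max_of_le_right
        (single_le_sum (f := fun j => (Nat.factorial j : ℝ)) (fun _ _ => by positivity)
          (mem_insert_self (N + 1) v)))
    refine (sum_le_card_nsmul _ _ _ hterm).trans ?_
    rw [card_powerset, Nat.card_Icc, nsmul_eq_mul, div_eq_mul_inv]
    push_cast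
    gcongr
    · norm_num
    · omega

open Finset in
theorem sum_powerset_inv_factorial_sum_le_exp_two (s : Finset ℕ) (hs : ∀ j ∈ s, 1 ≤ j) :
    ∑ v ∈ s.powerset, (max 1 (∑ j ∈ v, (Nat.factorial j : ℝ)))⁻¹ ≤ Real.exp 2 := by
  have hsub : s ⊆ Icc 1 (s.sup id) := fun j hj =>
    mem_Icc.2 ⟨hs j hj, le_sup (f := id) hj⟩
  calc _ ≤ ∑ v ∈ (Icc 1 (s.sup id)).powerset, (max 1 (∑ j ∈ v, (Nat.factorial j : ℝ)))⁻¹ :=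
        sum_le_sum_of_subset_of_nonneg (powerset_mono.2 hsub) fun _ _ _ => by positivity
    _ ≤ _ := sum_powerset_Icc_inv_factorial_sum_le _
    _ ≤ _ := Real.sum_le_exp_of_nonneg (by norm_num) _

/-- For `v ⊆ s`, the quotient of factorial sums splits into reciprocals. -/
theorem factorial_sum_div_mul_le {s v : Finset ℕ} (hv : v ⊆ s) :
    max 1 (∑ j ∈ s, (Nat.factorial j : ℝ)) / (max 1 (∑ j ∈ v, (Nat.factorial j : ℝ)) *
        max 1 (∑ j ∈ s \ v, (Nat.factorial j : ℝ))) ≤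
      (max 1 (∑ j ∈ v, (Nat.factorial j : ℝ)))⁻¹ +
        (max 1 (∑ j ∈ s \ v, (Nat.factorial j : ℝ)))⁻¹ := by
  rw [← Finset.sum_sdiff hv]
  generalize ∑ j ∈ v, (Nat.factorial j : ℝ) = x
  generalize ∑ j ∈ s \ v, (Nat.factorial j : ℝ) = y
  have hx : 0 < max 1 x := by positivity
  have hy : 0 < max 1 y := by positivity
  rw [inv_add_inv hx.ne' hy.ne']
  gcongr
  exact max_le (by linarith [le_max_left 1 x])
    (by linarith [le_max_right 1 x, le_max_right 1 y])

/-- With `ε₁ = e⁻²/8` and `a_s = ε₁ / Σ_{j∈s} j!` for finite nonempty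
sets `s` of positive integers (`a_∅ = ε₁`): `0 < a_s ≤ 1`, `a_{s∪v} ≤ a_s`, and
`Σ_{v ⊆ s} a_v a_{s∖v} / a_s ≤ 1/4`. -/
theorem a_s_estimates
    (ε₁ : ℝ) (hε : ε₁ = Real.exp (-2) / 8)
    (a : Finset ℕ → ℝ)
    (ha : ∀ s : Finset ℕ,
      a s = if s = ∅ then ε₁ else ε₁ / ∑ j ∈ s, (Nat.factorial j : ℝ)) :
    (∀ s : Finset ℕ, (∀ j ∈ s, 1 ≤ j) → 0 < a s ∧ a s ≤ 1) ∧
    (∀ s v : Finset ℕ, (∀ j ∈ s, 1 ≤ j) → (∀ j ∈ v, 1 ≤ j) → a (s ∪ v) ≤ a s) ∧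
    (∀ s : Finset ℕ, (∀ j ∈ s, 1 ≤ j) →
      ∑ v ∈ s.powerset, a v * a (s \ v) / a s ≤ 1 / 4) := by
  have hε0 : 0 < ε₁ := by rw [hε]; positivity
  have ha' : ∀ s, a s = ε₁ / max 1 (∑ j ∈ s, (Nat.factorial j : ℝ)) := by
    intro s
    rw [ha]
    split_ifs with h
    · simp [h]
    · obtain ⟨m, hm⟩ := Finset.nonempty_iff_ne_empty.2 h
      have hm1 : (1 : ℝ) ≤ (Nat.factorial m : ℝ) := by exact_mod_cast Nat.factorial_pos m
      rw [max_eq_right (hm1.trans (Finset.single_le_sum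
        (f := fun j => (Nat.factorial j : ℝ)) (fun _ _ => by positivity) hm))]
  refine ⟨fun s _ => ?_, fun s v _ _ => ?_, fun s hs => ?_⟩
  · rw [ha']
    refine ⟨by positivity, div_le_one_of_le₀ (le_max_of_le_left ?_) (by positivity)⟩
    have : Real.exp (-2) ≤ 1 := Real.exp_le_one_iff.2 (by norm_num)
    linarith
  · rw [ha', ha']
    gcongr
    exact Finset.subset_union_left
  · have hterm : ∀ v ∈ s.powerset, a v * a (s \ v) / a s ≤
        ε₁ * ((max 1 (∑ j ∈ v, (Nat.factorial j : ℝ)))⁻¹ +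
          (max 1 (∑ j ∈ s \ v, (Nat.factorial j : ℝ)))⁻¹) := by
      intro v hv
      refine le_trans (le_of_eq ?_) (mul_le_mul_of_nonneg_left
        (factorial_sum_div_mul_le (Finset.mem_powerset.1 hv)) hε0.le)
      rw [ha', ha', ha']
      field_simp
    have hcompl : ∑ v ∈ s.powerset, (max 1 (∑ j ∈ s \ v, (Nat.factorial j : ℝ)))⁻¹ =
        ∑ v ∈ s.powerset, (max 1 (∑ j ∈ v, (Nat.factorial j : ℝ)))⁻¹ :=
      Finset.sum_nbij' (s \ ·) (s \ ·) (by simp) (by simp)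
        (fun v hv => Finset.sdiff_sdiff_eq_self (Finset.mem_powerset.1 hv))
        (fun v hv => Finset.sdiff_sdiff_eq_self (Finset.mem_powerset.1 hv)) (by simp)
    refine (Finset.sum_le_sum hterm).trans ?_
    rw [← Finset.mul_sum, Finset.sum_add_distrib, hcompl]
    have hexp : Real.exp (-2) * Real.exp 2 = 1 := by rw [← Real.exp_add]; simp
    have := mul_le_mul_of_nonneg_left (sum_powerset_inv_factorial_sum_le_exp_two s hs) hε0.le
    rw [hε] at this ⊢
    linarith
end

section
/- On every countable discrete abelian group G there exists a function u : G → ℝ such that: (a) u(x) > 0 for all x; (b) Σ_{y ∈ G} u(y) u(x−y) ≤ u(x) for all x ∈ G; (c) u(−x) = u(x) for all x; (d) for every x ∈ G there exist C > 0 and d ∈ ℕ with 1/u(nx) ≤ C n^d for all n ≥ 1. -/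
open scoped ENNReal

namespace ConvolutionWeight

/-- The weight `n ↦ (|n| + 1)⁻²` on the integers. -/
noncomputable def intWeight (n : ℤ) : ℝ≥0∞ := ENNReal.ofReal (((|n| : ℤ) + 1 : ℝ) ^ 2)⁻¹

lemma intWeight_neg (n : ℤ) : intWeight (-n) = intWeight n := by
  simp [intWeight]

lemma intWeight_zero : intWeight 0 = 1 := by
  simp [intWeight]

lemma tsum_intWeight_ne_top : ∑' n, intWeight n ≠ ∞ := by
  have h : Summable fun n : ℕ => (((n : ℝ) + 1) ^ 2)⁻¹ := by
    have := (summable_nat_add_iff 1).2 (Real.summable_nat_pow_inv.2 (one_lt_two))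
    simpa using this
  have hs : Summable fun n : ℤ => (((|n| : ℤ) + 1 : ℝ) ^ 2)⁻¹ :=
    Summable.of_nat_of_neg (by simpa using h) (by simpa using h)
  exact hs.tsum_ofReal_ne_top

lemma one_le_tsum_intWeight : 1 ≤ ∑' n, intWeight n :=
  intWeight_zero ▸ ENNReal.le_tsum (0 : ℤ)

lemma intWeight_mul_le (n m : ℤ) :
    intWeight (n - m) * intWeight m ≤ 2 * (intWeight m + intWeight (n - m)) * intWeight n := by
  unfold intWeight
  rw [← ENNReal.ofReal_ofNat, ← ENNReal.ofReal_add (by positivity) (by positivity),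
    ← ENNReal.ofReal_mul (by positivity), ← ENNReal.ofReal_mul (by positivity),
    ← ENNReal.ofReal_mul (by positivity)]
  refine ENNReal.ofReal_le_ofReal ?_
  have htri : |(n : ℝ)| ≤ |((n - m : ℤ) : ℝ)| + |(m : ℝ)| := by
    simpa using abs_add_le ((n - m : ℤ) : ℝ) (m : ℝ)
  push_cast at htri ⊢
  set a := |(n : ℝ) - m|
  set b := |(m : ℝ)|
  set c := |(n : ℝ)|
  have ha : 0 ≤ a := abs_nonneg _
  have hb : 0 ≤ b := abs_nonneg _
  have hc : 0 ≤ c := abs_nonneg _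
  have key : (c + 1) ^ 2 ≤ 2 * ((a + 1) ^ 2 + (b + 1) ^ 2) := by
    nlinarith [sq_nonneg (a - b)]
  have e : 2 * (((b + 1) ^ 2)⁻¹ + ((a + 1) ^ 2)⁻¹) * ((c + 1) ^ 2)⁻¹
      = (2 * ((a + 1) ^ 2 + (b + 1) ^ 2)) * ((c + 1) ^ 2)⁻¹
        * (((a + 1) ^ 2)⁻¹ * ((b + 1) ^ 2)⁻¹) := by
    field_simp
  rw [e]
  refine le_mul_of_one_le_left (by positivity) ?_
  rw [← div_eq_mul_inv]
  exact (one_le_div (by positivity)).2 key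

/-- A constant bounding the self-convolution of `intWeight` in terms of `intWeight`. -/
noncomputable def convConst : ℝ≥0∞ := 4 * ∑' n, intWeight n

lemma convConst_ne_top : convConst ≠ ∞ :=
  ENNReal.mul_ne_top (by simp) tsum_intWeight_ne_top

lemma tsum_intWeight_le_convConst : ∑' n, intWeight n ≤ convConst :=
  le_mul_of_one_le_left' (by norm_num)

lemma convConst_ne_zero : convConst ≠ 0 :=
  (zero_lt_one.trans_le (one_le_tsum_intWeight.trans tsum_intWeight_le_convConst)).ne'

lemma tsum_intWeight_mul_le (n : ℤ) :
    ∑' m, intWeight (n - m) * intWeight m ≤ convConst * intWeight n := by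
  refine (ENNReal.tsum_le_tsum (intWeight_mul_le n)).trans_eq ?_
  rw [ENNReal.tsum_mul_right, ENNReal.tsum_mul_left, ENNReal.tsum_add,
    show ∑' m, intWeight (n - m) = ∑' m, intWeight m from (Equiv.subLeft n).tsum_eq intWeight,
    convConst]
  ring

variable {G : Type*} [AddCommGroup G]

/-- Convolution of extended nonnegative functions on an additive group. -/
noncomputable def conv (f h : G → ℝ≥0∞) (x : G) : ℝ≥0∞ := ∑' y, f y * h (x - y)

lemma conv_comm (f h : G → ℝ≥0∞) : conv f h = conv h f := by
  ext x
  rw [conv, conv, ← (Equiv.subLeft x).tsum_eq]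
  simp [mul_comm]

/-- Averaging of `f` along the multiples of `g`, with weights `intWeight`. -/
noncomputable def smear (g : G) (f : G → ℝ≥0∞) (x : G) : ℝ≥0∞ :=
  ∑' n : ℤ, intWeight n * f (x - n • g)

lemma smear_mono (g : G) {f h : G → ℝ≥0∞} (hfh : f ≤ h) : smear g f ≤ smear g h :=
  fun _ => ENNReal.tsum_le_tsum fun _ => mul_le_mul_right (hfh _) _

lemma smear_const_mul (g : G) (c : ℝ≥0∞) (f : G → ℝ≥0∞) :
    smear g (fun x => c * f x) = fun x => c * smear g f x := by
  ext x
  simp only [smear, ← ENNReal.tsum_mul_left]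
  exact tsum_congr fun n => by ring

lemma smear_comm (g g' : G) (f : G → ℝ≥0∞) :
    smear g (smear g' f) = smear g' (smear g f) := by
  ext x
  simp only [smear, ← ENNReal.tsum_mul_left]
  rw [ENNReal.tsum_comm]
  refine tsum_congr fun n => tsum_congr fun m => ?_
  rw [sub_right_comm]
  ring

lemma smear_smear_le (g : G) (f : G → ℝ≥0∞) :
    smear g (smear g f) ≤ fun x => convConst * smear g f x := by
  intro x
  have e : smear g (smear g f) x
      = ∑' p : ℤ, (∑' m, intWeight (p - m) * intWeight m) * f (x - p • g) := by
    simp only [smear, ← ENNReal.tsum_mul_left, ← ENNReal.tsum_mul_right]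
    rw [ENNReal.tsum_comm]
    conv_rhs => rw [ENNReal.tsum_comm]
    refine tsum_congr fun m => ?_
    conv_rhs => rw [← (Equiv.addRight m).tsum_eq]
    refine tsum_congr fun n => ?_
    simp [mul_assoc, add_smul, sub_sub]
  rw [e]
  simp only [smear, ← ENNReal.tsum_mul_left]
  refine ENNReal.tsum_le_tsum fun p => ?_
  rw [← mul_assoc]
  exact mul_le_mul_left (tsum_intWeight_mul_le p) _

lemma conv_smear (g : G) (f h : G → ℝ≥0∞) : conv (smear g f) h = smear g (conv f h) := by
  ext x
  simp only [conv, smear, ← ENNReal.tsum_mul_left, ← ENNReal.tsum_mul_right]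
  rw [ENNReal.tsum_comm]
  refine tsum_congr fun n => ?_
  rw [← (Equiv.addRight (n • g)).tsum_eq]
  refine tsum_congr fun y => ?_
  simp [mul_assoc, sub_add_eq_sub_sub_swap]

lemma smear_neg (g : G) {f : G → ℝ≥0∞} (hf : ∀ x, f (-x) = f x) (x : G) :
    smear g f (-x) = smear g f x := by
  rw [smear, smear, ← (Equiv.neg ℤ).tsum_eq]
  refine tsum_congr fun n => ?_
  rw [Equiv.neg_apply, intWeight_neg, ← hf]
  simp [sub_eq_add_neg, add_comm]

lemma smear_le_const (g : G) {f : G → ℝ≥0∞} {c : ℝ≥0∞} (hf : ∀ x, f x ≤ c) (x : G) :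
    smear g f x ≤ convConst * c := by
  refine le_trans ?_ (mul_le_mul_left tsum_intWeight_le_convConst c)
  rw [← ENNReal.tsum_mul_right]
  exact ENNReal.tsum_le_tsum fun _ => mul_le_mul_right (hf _) _

/-- The point mass at `0` smeared successively along `e 0, …, e (k - 1)`. -/
noncomputable def layer (e : ℕ → G) : ℕ → G → ℝ≥0∞
  | 0 => Set.indicator {0} 1
  | k + 1 => smear (e k) (layer e k)

variable (e : ℕ → G)

lemma layer_neg (k : ℕ) (x : G) : layer e k (-x) = layer e k x := by
  induction k generalizing x with
  | zero =>
    classical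
    simp only [layer, Set.indicator_apply, Set.mem_singleton_iff, neg_eq_zero]
    rfl
  | succ k ih => exact smear_neg _ ih x

lemma layer_le (k : ℕ) (x : G) : layer e k x ≤ convConst ^ k := by
  induction k generalizing x with
  | zero => exact by rw [pow_zero]; exact Set.indicator_le_self _ _ x
  | succ k ih => rw [pow_succ']; exact smear_le_const _ ih x

lemma intWeight_mul_layer_le (k : ℕ) (n : ℤ) (x : G) :
    intWeight n * layer e k (x - n • e k) ≤ layer e (k + 1) x :=
  ENNReal.le_tsum (f := fun n : ℤ => intWeight n * layer e k (x - n • e k)) n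

lemma one_le_layer_zero (k : ℕ) : 1 ≤ layer e k 0 := by
  induction k with
  | zero => simp [layer]
  | succ k ih => exact ih.trans (by simpa [intWeight_zero] using intWeight_mul_layer_le e k 0 0)

lemma intWeight_le_layer (k : ℕ) (n : ℤ) : intWeight n ≤ layer e (k + 1) (n • e k) := by
  have h := intWeight_mul_layer_le e k n (n • e k)
  rw [sub_self] at h
  exact (le_mul_of_one_le_right' (one_le_layer_zero e k)).trans h

lemma smear_layer_le {i k : ℕ} (hik : i < k) :
    smear (e i) (layer e k) ≤ fun x => convConst * layer e k x := by
  induction k with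
  | zero => omega
  | succ k ih =>
    rcases (Nat.lt_succ_iff.1 hik).eq_or_lt with rfl | hlt
    · exact smear_smear_le _ _
    · calc smear (e i) (layer e (k + 1)) = smear (e k) (smear (e i) (layer e k)) :=
          smear_comm _ _ _
        _ ≤ smear (e k) (fun x => convConst * layer e k x) := smear_mono _ (ih hlt)
        _ = _ := smear_const_mul _ _ _

lemma conv_layer_le {j k : ℕ} (hjk : j ≤ k) :
    conv (layer e j) (layer e k) ≤ fun x => convConst ^ j * layer e k x := by
  induction j with
  | zero =>
    intro x
    rw [conv, tsum_eq_single 0 (by intro y hy; simp [layer, hy])]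
    simp [layer]
  | succ j ih =>
    calc conv (layer e (j + 1)) (layer e k) = smear (e j) (conv (layer e j) (layer e k)) :=
          conv_smear _ _ _
      _ ≤ smear (e j) (fun x => convConst ^ j * layer e k x) := smear_mono _ (ih (by omega))
      _ = fun x => convConst ^ j * smear (e j) (layer e k) x := smear_const_mul _ _ _
      _ ≤ _ := fun x => by
        rw [pow_succ, mul_assoc]
        exact mul_le_mul_right (smear_layer_le e hjk x) _

lemma conv_layer_le_add (j k : ℕ) (x : G) :
    conv (layer e j) (layer e k) x ≤ convConst ^ j * layer e k x + convConst ^ k * layer e j x := by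
  rcases le_total j k with h | h
  · exact (conv_layer_le e h x).trans le_self_add
  · rw [conv_comm]
    exact (conv_layer_le e h x).trans le_add_self

/-- The coefficient of the `k`-th layer in `weight`. -/
noncomputable def coeff (k : ℕ) : ℝ≥0∞ := 4⁻¹ * 2⁻¹ ^ k * (convConst ^ k)⁻¹

lemma coeff_pos (k : ℕ) : 0 < coeff k := by
  simp [coeff, pos_iff_ne_zero, convConst_ne_top]

lemma coeff_ne_top (k : ℕ) : coeff k ≠ ∞ := by
  refine ENNReal.mul_ne_top (ENNReal.mul_ne_top (by simp) (by simp)) ?_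
  simp [convConst_ne_zero]

lemma tsum_coeff_mul : ∑' k, coeff k * convConst ^ k = 2⁻¹ := by
  have h (k : ℕ) : coeff k * convConst ^ k = 4⁻¹ * 2⁻¹ ^ k := by
    rw [coeff, mul_assoc, ENNReal.inv_mul_cancel (pow_ne_zero _ convConst_ne_zero)
      (ENNReal.pow_ne_top convConst_ne_top), mul_one]
  simp_rw [h, ENNReal.tsum_mul_left, ENNReal.tsum_geometric, ENNReal.one_sub_inv_two, inv_inv]
  rw [show (4 : ℝ≥0∞) = 2 * 2 by norm_num, ENNReal.mul_inv (by simp) (by simp), mul_assoc,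
    ENNReal.inv_mul_cancel (by simp) (by simp), mul_one]

/-- The weight associated with a sequence in `G`: a weighted sum of the layers. -/
noncomputable def weight (x : G) : ℝ≥0∞ := ∑' k, coeff k * layer e k x

lemma weight_neg (x : G) : weight e (-x) = weight e x := by
  simp [weight, layer_neg]

lemma weight_ne_top (x : G) : weight e x ≠ ∞ := by
  refine ne_top_of_le_ne_top (b := 2⁻¹) (by simp) ?_
  rw [← tsum_coeff_mul]
  exact ENNReal.tsum_le_tsum fun k => mul_le_mul_right (layer_le e k x) _

lemma coeff_mul_intWeight_le (k : ℕ) (n : ℤ) :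
    coeff (k + 1) * intWeight n ≤ weight e (n • e k) :=
  (mul_le_mul_right (intWeight_le_layer e k n) _).trans
    (ENNReal.le_tsum (f := fun k' => coeff k' * layer e k' (n • e k)) (k + 1))

lemma conv_weight_le (x : G) : conv (weight e) (weight e) x ≤ weight e x := by
  have expand : conv (weight e) (weight e) x
      = ∑' j, ∑' k, coeff j * coeff k * conv (layer e j) (layer e k) x := by
    simp only [conv, weight, ← ENNReal.tsum_mul_left, ← ENNReal.tsum_mul_right]
    rw [ENNReal.tsum_comm]
    conv_rhs => rw [ENNReal.tsum_comm]
    refine tsum_congr fun k => ?_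
    rw [ENNReal.tsum_comm]
    refine tsum_congr fun j => tsum_congr fun y => ?_
    ring
  have half (y : ℝ≥0∞) : 2⁻¹ * y + 2⁻¹ * y = y := by
    rw [← add_mul, ENNReal.inv_two_add_inv_two, one_mul]
  have swap : ∑' j, ∑' k, (coeff j * convConst ^ j) * (coeff k * layer e k x)
      = 2⁻¹ * weight e x := by
    simp_rw [ENNReal.tsum_mul_left, ENNReal.tsum_mul_right, tsum_coeff_mul]
    rfl
  calc conv (weight e) (weight e) x
      ≤ ∑' j, ∑' k, ((coeff j * convConst ^ j) * (coeff k * layer e k x)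
          + (coeff k * convConst ^ k) * (coeff j * layer e j x)) := by
        rw [expand]
        refine ENNReal.tsum_le_tsum fun j => ENNReal.tsum_le_tsum fun k => ?_
        refine (mul_le_mul_right (conv_layer_le_add e j k x) _).trans_eq ?_
        ring
    _ = weight e x := by
        simp_rw [ENNReal.tsum_add]
        rw [ENNReal.tsum_comm (f := fun j k => (coeff k * convConst ^ k) * (coeff j * layer e j x)),
          swap, half]

end ConvolutionWeight


/-- On every countable discrete abelian group `G` there is a function `u`
which is positive (a), satisfies `u*u ≤ u` pointwise with the convolution sum
converging (b), is even (c), and `1/u(nx)` grows at most polynomially in `n` (d). -/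
theorem exists_weight_countable_discrete_abelian
    {G : Type*} [AddCommGroup G] [Countable G] :
    ∃ u : G → ℝ,
      (∀ x, 0 < u x) ∧
      (∀ x : G, Summable (fun y : G => u y * u (x - y)) ∧
        ∑' y : G, u y * u (x - y) ≤ u x) ∧
      (∀ x, u (-x) = u x) ∧
      (∀ x : G, ∃ C > (0 : ℝ), ∃ d : ℕ, ∀ n : ℕ, 1 ≤ n →
        1 / u (n • x) ≤ C * (n : ℝ) ^ d) := by
  classical
  obtain ⟨e, he⟩ := exists_surjective_nat G
  let w : G → ENNReal := ConvolutionWeight.weight e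
  have hw_top (x : G) : w x ≠ ⊤ := ConvolutionWeight.weight_ne_top e x
  have hlow (k : ℕ) : ∃ c > (0 : ℝ), ∀ n : ℕ, c * (((n : ℝ) + 1) ^ 2)⁻¹ ≤ (w (n • e k)).toReal := by
    refine ⟨(ConvolutionWeight.coeff (k + 1)).toReal, ENNReal.toReal_pos
      (ConvolutionWeight.coeff_pos _).ne' (ConvolutionWeight.coeff_ne_top _), fun n => ?_⟩
    have h := ENNReal.toReal_mono (hw_top _)
      (by simpa using ConvolutionWeight.coeff_mul_intWeight_le e k n)
    rw [ENNReal.toReal_mul, ConvolutionWeight.intWeight, ENNReal.toReal_ofReal (by positivity)] at h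
    simpa using h
  have hpos (x : G) : 0 < (w x).toReal := by
    obtain ⟨k, rfl⟩ := he x
    obtain ⟨c, hc, h⟩ := hlow k
    have := h 1
    rw [one_smul] at this
    exact lt_of_lt_of_le (by positivity) this
  have hconv (x : G) : ∑' y, w y * w (x - y) ≤ w x := ConvolutionWeight.conv_weight_le e x
  have hconv_top (x : G) : ∑' y, w y * w (x - y) ≠ ⊤ := ne_top_of_le_ne_top (hw_top x) (hconv x)
  refine ⟨fun x => (w x).toReal, hpos, fun x => ?_, fun x => ?_, fun x => ?_⟩
  · simp_rw [← ENNReal.toReal_mul]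
    refine ⟨ENNReal.summable_toReal (hconv_top x), ?_⟩
    rw [← ENNReal.tsum_toReal_eq fun y => ENNReal.mul_ne_top (hw_top _) (hw_top _)]
    exact ENNReal.toReal_mono (hw_top x) (hconv x)
  · exact congrArg ENNReal.toReal (ConvolutionWeight.weight_neg e x)
  · obtain ⟨k, rfl⟩ := he x
    obtain ⟨c, hc, h⟩ := hlow k
    refine ⟨4 / c, by positivity, 2, fun n hn => ?_⟩
    have hn' : (1 : ℝ) ≤ n := by exact_mod_cast hn
    calc 1 / (w (n • e k)).toReal ≤ 1 / (c * (((n : ℝ) + 1) ^ 2)⁻¹) :=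
          one_div_le_one_div_of_le (by positivity) (h n)
      _ = (n + 1) ^ 2 / c := by field_simp
      _ ≤ (4 * n ^ 2) / c := by
          gcongr
          nlinarith
      _ = 4 / c * n ^ 2 := by ring
end
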